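/- Let E and F be vector lattices with F Dedekind complete, and let S, T : E → F be orthogonally additive order bounded operators. Then for every f ∈ E the set {T(g) + S(h) : g, h ∈ E, g ⊥ h, g + h = f} has a supremum in F, and the map R : E → F defined by R(f) = sup{T(g) + S(h) : f = g + h, g ⊥ h} is an orthogonally additive order bounded operator which is the least upper bound of T and S: R − T and R − S are positive (take only nonnegative values), and for every orthogonally additive order bounded U : E → F such that U − T and U − S are positive, U − R is positive. -/

import Mathlib

/-- Disjointness in a lattice-ordered group: `|x| ⊓ |y| = 0`. -/
def OrthDisjoint {E : Type*} [Lattice E] [AddCommGroup E] (x y : E) : Prop :=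
  |x| ⊓ |y| = 0

/-- `y` is a fragment of `x`: `y ⊥ (x - y)`. -/
def Fragment {E : Type*} [Lattice E] [AddCommGroup E] (y x : E) : Prop :=
  OrthDisjoint y (x - y)

/-- Orthogonally additive map. -/
def IsOrthAdditive {E : Type*} [Lattice E] [AddCommGroup E] {X : Type*} [AddCommGroup X]
    (T : E → X) : Prop :=
  ∀ x y : E, OrthDisjoint x y → T (x + y) = T x + T y

/-- `e` is an atom of the vector lattice. -/
def IsVLAtom {E : Type*} [Lattice E] [AddCommGroup E] (e : E) : Prop :=
  0 < e ∧ ∀ f₁ f₂ : E, 0 ≤ f₁ → f₁ ≤ e → 0 ≤ f₂ → f₂ ≤ e →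
    OrthDisjoint f₁ f₂ → f₁ = 0 ∨ f₂ = 0

/-- Atomless vector lattice. -/
def Atomless (E : Type*) [Lattice E] [AddCommGroup E] : Prop :=
  ∀ e : E, ¬ IsVLAtom e

/-- Narrow operator into a normed space. -/
def IsNarrow {E : Type*} [Lattice E] [AddCommGroup E] {X : Type*} [SeminormedAddCommGroup X]
    (T : E → X) : Prop :=
  ∀ x : E, ∀ ε : ℝ, 0 < ε → ∃ x₁ x₂ : E, Fragment x₁ x ∧ Fragment x₂ x ∧ x = x₁ + x₂ ∧
    ‖T x₁ - T x₂‖ < ε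

/-- A net order converges to zero. -/
def NetOrderConvZero {F : Type*} [Lattice F] [AddCommGroup F] {A : Type*} [Preorder A]
    (y : A → F) : Prop :=
  ∃ (B : Type) (_ : Preorder B) (f : B → F),
    IsDirected B (· ≤ ·) ∧ Nonempty B ∧
    (∀ b₁ b₂ : B, b₁ ≤ b₂ → f b₂ ≤ f b₁) ∧
    IsGLB (Set.range f) 0 ∧
    ∀ b : B, ∃ a₀ : A, ∀ a : A, a₀ ≤ a → |y a| ≤ f b

/-- Order narrow operator between vector lattices. -/
def IsOrderNarrow {E : Type*} [Lattice E] [AddCommGroup E] {F : Type*} [Lattice F]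
    [AddCommGroup F] (T : E → F) : Prop :=
  ∀ x : E, ∃ (A : Type) (_ : Preorder A), IsDirected A (· ≤ ·) ∧ Nonempty A ∧
    ∃ x₁ x₂ : A → E,
      (∀ a : A, Fragment (x₁ a) x ∧ Fragment (x₂ a) x ∧ x = x₁ a + x₂ a) ∧
      NetOrderConvZero (fun a => T (x₁ a) - T (x₂ a))

/-- Lateral convergence of a net to `v`. -/
def LaterallyConvTo {E : Type*} [Lattice E] [AddCommGroup E] {A : Type*} [Preorder A]
    (x : A → E) (v : E) : Prop :=
  (∀ a b : A, a ≤ b → Fragment (x a) (x b)) ∧ (∀ a : A, Fragment (x a) v) ∧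
    NetOrderConvZero (fun a => x a - v)

/-- Laterally-to-norm continuous operator. -/
def LatToNormCont {E : Type*} [Lattice E] [AddCommGroup E] {X : Type*}
    [SeminormedAddCommGroup X] (T : E → X) : Prop :=
  ∀ (A : Type) (_ : Preorder A), IsDirected A (· ≤ ·) → Nonempty A →
    ∀ (x : A → E) (v : E), LaterallyConvTo x v →
      Filter.Tendsto (fun a => T (x a)) Filter.atTop (nhds (T v))

/-- Order bounded operator. -/
def IsOrderBounded {E : Type*} [Preorder E] {F : Type*} [Preorder F] (T : E → F) : Prop :=
  ∀ s : Set E, BddBelow s → BddAbove s → BddBelow (T '' s) ∧ BddAbove (T '' s)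

/-- C-compact operator. -/
def IsCCompact {E : Type*} [Lattice E] [AddCommGroup E] {X : Type*} [SeminormedAddCommGroup X]
    (T : E → X) : Prop :=
  ∀ x : E, TotallyBounded (T '' {y : E | Fragment y x})


section Helpers

variable {E : Type*} [AddCommGroup E] [Lattice E] [CovariantClass E E (· + ·) (· ≤ ·)]

theorem aux_inf_add_le {a b c : E} (ha : 0 ≤ a) (hb : 0 ≤ b) (hc : 0 ≤ c) :
    a ⊓ (b + c) ≤ a ⊓ b + a ⊓ c := by
  rw [add_inf, inf_add, inf_add]
  refine le_inf (le_inf ?_ ?_) (le_inf ?_ ?_)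
  · exact inf_le_left.trans (le_add_of_nonneg_left ha)
  · exact inf_le_left.trans (le_add_of_nonneg_left hb)
  · exact inf_le_left.trans (le_add_of_nonneg_right hc)
  · exact inf_le_right

theorem aux_add_zero {a b c : E} (ha : 0 ≤ a) (hb : 0 ≤ b) (hc : 0 ≤ c)
    (h1 : a ⊓ b = 0) (h2 : a ⊓ c = 0) : a ⊓ (b + c) = 0 := by
  refine le_antisymm ?_ (le_inf ha (add_nonneg hb hc))
  have := aux_inf_add_le ha hb hc
  rwa [h1, h2, add_zero] at this

theorem aux_symm {x y : E} (h : OrthDisjoint x y) : OrthDisjoint y x := by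
  unfold OrthDisjoint at *
  rwa [inf_comm]

theorem aux_mono {x y x' y' : E} (h : OrthDisjoint x y) (hx : |x'| ≤ |x|) (hy : |y'| ≤ |y|) :
    OrthDisjoint x' y' := by
  unfold OrthDisjoint at *
  refine le_antisymm ?_ (le_inf (abs_nonneg _) (abs_nonneg _))
  rw [← h]
  exact inf_le_inf hx hy

theorem aux_orth_add {x y z : E} (h1 : OrthDisjoint x y) (h2 : OrthDisjoint x z) :
    OrthDisjoint x (y + z) := by
  unfold OrthDisjoint at *
  have := aux_add_zero (abs_nonneg x) (abs_nonneg y) (abs_nonneg z) h1 h2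
  refine le_antisymm ?_ (le_inf (abs_nonneg _) (abs_nonneg _))
  rw [← this]
  exact inf_le_inf le_rfl (abs_add_le y z)

theorem aux_abs_le {g h : E} (hd : OrthDisjoint g h) : |g| ≤ |g + h| := by
  have h1 : |g| ≤ |g + h| + |h| := by
    have := abs_add_le (g + h) (-h)
    rwa [abs_neg, add_neg_cancel_right] at this
  have h2 := aux_inf_add_le (abs_nonneg g) (abs_nonneg (g + h)) (abs_nonneg h)
  rw [inf_eq_left.mpr h1] at h2
  unfold OrthDisjoint at hd
  rw [hd, add_zero] at h2
  exact h2.trans inf_le_right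

theorem aux_pos_zero {x y a b : E} (h : OrthDisjoint x y) (ha : 0 ≤ a) (hb : 0 ≤ b)
    (hx : a ≤ |x|) (hy : b ≤ |y|) : a ⊓ b = 0 := by
  unfold OrthDisjoint at h
  refine le_antisymm ?_ (le_inf ha hb)
  rw [← h]
  exact inf_le_inf hx hy

theorem aux_posle (x : E) : x⁺ ≤ |x| := by
  rw [← posPart_add_negPart]; exact le_add_of_nonneg_right (negPart_nonneg x)

theorem aux_negle (x : E) : x⁻ ≤ |x| := by
  rw [← posPart_add_negPart]; exact le_add_of_nonneg_left (posPart_nonneg x)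

theorem aux_pn (x : E) : x⁺ ⊓ x⁻ = 0 := posPart_inf_negPart_eq_zero x

theorem aux_pos_add {g h : E} (hd : OrthDisjoint g h) : (g + h)⁺ = g⁺ + h⁺ := by
  have p := fun x : E => posPart_nonneg x
  have n := fun x : E => negPart_nonneg x
  have key : (g⁺ + h⁺) ⊓ (g⁻ + h⁻) = 0 := by
    rw [inf_comm]
    refine aux_add_zero (add_nonneg (n g) (n h)) (p g) (p h) ?_ ?_
    · rw [inf_comm]
      exact aux_add_zero (p g) (n g) (n h) (aux_pn g)
        (aux_pos_zero hd (p g) (n h) (aux_posle g) (aux_negle h))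
    · rw [inf_comm]
      exact aux_add_zero (p h) (n g) (n h)
        (aux_pos_zero (aux_symm hd) (p h) (n g) (aux_posle h) (aux_negle g)) (aux_pn h)
  have e : g + h = (g⁺ + h⁺) - (g⁻ + h⁻) := by
    conv_lhs => rw [← posPart_sub_negPart g, ← posPart_sub_negPart h]
    abel
  have e2 := inf_add_sup (g⁺ + h⁺) (g⁻ + h⁻)
  rw [key, zero_add] at e2
  rw [posPart_def, e]
  have e3 : (g⁺ + h⁺ - (g⁻ + h⁻)) ⊔ 0 = (g⁺ + h⁺) ⊔ (g⁻ + h⁻) - (g⁻ + h⁻) := by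
    rw [sup_sub, sub_self]
  rw [e3, e2, add_sub_cancel_right]

theorem aux_neg_add {g h : E} (hd : OrthDisjoint g h) : (g + h)⁻ = g⁻ + h⁻ := by
  have : OrthDisjoint (-g) (-h) := by
    unfold OrthDisjoint at *
    rwa [abs_neg, abs_neg]
  have h2 := aux_pos_add this
  rwa [← neg_add, posPart_neg, posPart_neg, posPart_neg] at h2

theorem aux_split_pos {a b c d : E} (hb : 0 ≤ b) (hc : 0 ≤ c) (hd : 0 ≤ d) (ha : 0 ≤ a)
    (hcd : c ⊓ d = 0) (h : a + b = c + d) : a = a ⊓ c + a ⊓ d := by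
  apply le_antisymm
  · have h1 := aux_inf_add_le ha hc hd
    rwa [← h, inf_eq_left.mpr (le_add_of_nonneg_right hb)] at h1
  · have h0 : (a ⊓ c) ⊓ (a ⊓ d) = 0 :=
      le_antisymm ((inf_le_inf inf_le_right inf_le_right).trans hcd.le)
        (le_inf (le_inf ha hc) (le_inf ha hd))
    rw [← inf_add_sup, h0, zero_add]
    exact sup_le inf_le_left inf_le_left

/-- the part of `g` in `x` -/
def auxPart (g x : E) : E := g⁺ ⊓ x⁺ - g⁻ ⊓ x⁻

theorem auxPart_comm (g x : E) : auxPart g x = auxPart x g := by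
  unfold auxPart; rw [inf_comm, inf_comm g⁻]

theorem auxPart_le (g x : E) : |auxPart g x| ≤ |g| := by
  have p : 0 ≤ g⁺ ⊓ x⁺ := le_inf (posPart_nonneg g) (posPart_nonneg x)
  have n : 0 ≤ g⁻ ⊓ x⁻ := le_inf (negPart_nonneg g) (negPart_nonneg x)
  have h1 : |auxPart g x| ≤ g⁺ ⊓ x⁺ + g⁻ ⊓ x⁻ := by
    have := abs_add_le (g⁺ ⊓ x⁺) (-(g⁻ ⊓ x⁻))
    rwa [abs_neg, abs_of_nonneg p, abs_of_nonneg n, ← sub_eq_add_neg] at this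
  refine h1.trans ?_
  rw [← posPart_add_negPart]
  exact add_le_add inf_le_left inf_le_left

theorem auxPart_split {g h x y : E} (hgh : OrthDisjoint g h) (hxy : OrthDisjoint x y)
    (e : g + h = x + y) : auxPart g x + auxPart g y = g := by
  have p := fun x : E => posPart_nonneg x
  have n := fun x : E => negPart_nonneg x
  have e1 : g⁺ + h⁺ = x⁺ + y⁺ := by rw [← aux_pos_add hgh, ← aux_pos_add hxy, e]
  have e2 : g⁻ + h⁻ = x⁻ + y⁻ := by rw [← aux_neg_add hgh, ← aux_neg_add hxy, e]
  have s1 := aux_split_pos (p h) (p x) (p y) (p g)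
    (aux_pos_zero hxy (p x) (p y) (aux_posle x) (aux_posle y)) e1
  have s2 := aux_split_pos (n h) (n x) (n y) (n g)
    (aux_pos_zero hxy (n x) (n y) (aux_negle x) (aux_negle y)) e2
  conv_rhs => rw [← posPart_sub_negPart g, s1, s2]
  unfold auxPart
  abel

theorem aux_orth_zero (x : E) : OrthDisjoint x 0 := by
  unfold OrthDisjoint
  rw [abs_zero]
  exact inf_eq_right.mpr (abs_nonneg x)

end Helpers

/-- For orthogonally additive order bounded operators `S, T : E → F` into a
Dedekind complete vector lattice, the map
`R f = sup {T g + S h : f = g + h, g ⊥ h}` is well defined (the supremum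
exists), orthogonally additive, order bounded, and is the least upper bound of
`T` and `S` among orthogonally additive order bounded operators. -/
theorem uryson_sup_exists {E F : Type*}
    [AddCommGroup E] [Lattice E] [CovariantClass E E (· + ·) (· ≤ ·)]
    [Module ℝ E] [PosSMulMono ℝ E]
    [AddCommGroup F] [ConditionallyCompleteLattice F]
    [CovariantClass F F (· + ·) (· ≤ ·)] [Module ℝ F] [PosSMulMono ℝ F]
    (T S : E → F) (hT : IsOrthAdditive T) (hTob : IsOrderBounded T)
    (hS : IsOrthAdditive S) (hSob : IsOrderBounded S) :
    ∃ R : E → F,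
      (∀ f : E,
        IsLUB {y : F | ∃ g h : E, OrthDisjoint g h ∧ g + h = f ∧ y = T g + S h} (R f)) ∧
      IsOrthAdditive R ∧ IsOrderBounded R ∧
      (∀ x : E, 0 ≤ R x - T x) ∧ (∀ x : E, 0 ≤ R x - S x) ∧
      (∀ U : E → F, IsOrthAdditive U → IsOrderBounded U →
        (∀ x : E, 0 ≤ U x - T x) → (∀ x : E, 0 ≤ U x - S x) →
        ∀ x : E, 0 ≤ U x - R x) := by
  have T0 : T 0 = 0 := by
    have := hT 0 0 (aux_orth_zero 0)
    rw [add_zero] at this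
    exact left_eq_add.mp this
  have S0 : S 0 = 0 := by
    have := hS 0 0 (aux_orth_zero 0)
    rw [add_zero] at this
    exact left_eq_add.mp this
  -- uniform bound on symmetric order intervals
  have bound : ∀ c : E, ∃ M : F, ∀ g h : E, OrthDisjoint g h → |g + h| ≤ c →
      T g + S h ≤ M := by
    intro c
    obtain ⟨M1, hM1⟩ := (hTob (Set.Icc (-c) c) bddBelow_Icc bddAbove_Icc).2
    obtain ⟨M2, hM2⟩ := (hSob (Set.Icc (-c) c) bddBelow_Icc bddAbove_Icc).2
    refine ⟨M1 + M2, fun g h hd hle => ?_⟩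
    have hg : |g| ≤ c := (aux_abs_le hd).trans hle
    have hh : |h| ≤ c := by
      have := aux_abs_le (aux_symm hd)
      rw [add_comm] at this
      exact this.trans hle
    have mem : ∀ u : E, |u| ≤ c → u ∈ Set.Icc (-c) c := fun u hu =>
      ⟨neg_le.mp ((neg_le_abs u).trans hu), (le_abs_self u).trans hu⟩
    exact add_le_add (hM1 ⟨g, mem g hg, rfl⟩) (hM2 ⟨h, mem h hh, rfl⟩)
  let A : E → Set F := fun f =>
    {y : F | ∃ g h : E, OrthDisjoint g h ∧ g + h = f ∧ y = T g + S h}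
  have memT : ∀ f, T f ∈ A f := fun f =>
    ⟨f, 0, aux_orth_zero f, add_zero f, by rw [S0, add_zero]⟩
  have memS : ∀ f, S f ∈ A f := fun f =>
    ⟨0, f, aux_symm (aux_orth_zero f), zero_add f, by rw [T0, zero_add]⟩
  have lub : ∀ f, IsLUB (A f) (sSup (A f)) := by
    intro f
    refine isLUB_csSup ⟨_, memT f⟩ ?_
    obtain ⟨M, hM⟩ := bound |f|
    refine ⟨M, ?_⟩
    rintro y ⟨g, h, hd, he, rfl⟩
    exact hM g h hd (by rw [he])
  refine ⟨fun f => sSup (A f), lub, ?_, ?_, ?_, ?_, ?_⟩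
  · intro x y hxy
    apply le_antisymm
    · refine (lub (x + y)).2 ?_
      rintro _ ⟨g, h, hd, he, rfl⟩
      have he' : h + g = x + y := by rw [add_comm, he]
      have hgx := auxPart_split hd hxy he
      have hhx := auxPart_split (aux_symm hd) hxy he'
      have hxg := auxPart_split hxy hd he.symm
      have hyg := auxPart_split (aux_symm hxy) hd (by rw [add_comm, he])
      have lex : ∀ u v : E, |auxPart u v| ≤ |v| := fun u v => by
        rw [auxPart_comm]; exact auxPart_le v u
      have dT := hT _ _ (aux_mono hxy (lex g x) (lex g y))
      have dS := hS _ _ (aux_mono hxy (lex h x) (lex h y))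
      rw [hgx] at dT
      rw [hhx] at dS
      have m1 : T (auxPart g x) + S (auxPart h x) ∈ A x :=
        ⟨_, _, aux_mono hd (auxPart_le g x) (auxPart_le h x),
          by rw [auxPart_comm g, auxPart_comm h, hxg], rfl⟩
      have m2 : T (auxPart g y) + S (auxPart h y) ∈ A y :=
        ⟨_, _, aux_mono hd (auxPart_le g y) (auxPart_le h y),
          by rw [auxPart_comm g, auxPart_comm h, hyg], rfl⟩
      rw [dT, dS, add_add_add_comm]
      exact add_le_add ((lub x).1 m1) ((lub y).1 m2)
    · rw [← le_sub_iff_add_le]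
      refine (lub x).2 ?_
      rintro _ ⟨g1, h1, hd1, he1, rfl⟩
      rw [le_sub_comm]
      refine (lub y).2 ?_
      rintro _ ⟨g2, h2, hd2, he2, rfl⟩
      rw [le_sub_iff_add_le']
      have lg1 : |g1| ≤ |x| := by rw [← he1]; exact aux_abs_le hd1
      have lh1 : |h1| ≤ |x| := by rw [← he1, add_comm]; exact aux_abs_le (aux_symm hd1)
      have lg2 : |g2| ≤ |y| := by rw [← he2]; exact aux_abs_le hd2
      have lh2 : |h2| ≤ |y| := by rw [← he2, add_comm]; exact aux_abs_le (aux_symm hd2)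
      refine (lub (x + y)).1 ⟨g1 + g2, h1 + h2, ?_, ?_, ?_⟩
      · refine aux_orth_add (aux_symm (aux_orth_add (aux_symm hd1) ?_))
          (aux_symm (aux_orth_add ?_ (aux_symm hd2)))
        · exact aux_mono hxy lh1 lg2
        · exact aux_symm (aux_mono hxy lg1 lh2)
      · rw [add_add_add_comm, he1, he2]
      · rw [hT _ _ (aux_mono hxy lg1 lg2), hS _ _ (aux_mono hxy lh1 lh2), add_add_add_comm]
  · intro s hb ha
    constructor
    · obtain ⟨m, hm⟩ := (hTob s hb ha).1
      refine ⟨m, ?_⟩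
      rintro _ ⟨f, hf, rfl⟩
      exact (hm ⟨f, hf, rfl⟩).trans ((lub f).1 (memT f))
    · obtain ⟨a, ha'⟩ := hb
      obtain ⟨b, hb'⟩ := ha
      obtain ⟨M, hM⟩ := bound (|a| ⊔ |b|)
      refine ⟨M, ?_⟩
      rintro _ ⟨f, hf, rfl⟩
      refine (lub f).2 ?_
      rintro _ ⟨g, h, hd, he, rfl⟩
      refine hM g h hd ?_
      rw [he]
      refine sup_le ?_ ?_
      · exact ((hb' hf).trans (le_abs_self b)).trans le_sup_right
      · exact ((neg_le_neg_iff.mpr (ha' hf)).trans (neg_le_abs a)).trans le_sup_left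
  · exact fun x => sub_nonneg.mpr ((lub x).1 (memT x))
  · exact fun x => sub_nonneg.mpr ((lub x).1 (memS x))
  · intro U hU _ hUT hUS x
    refine sub_nonneg.mpr ((lub x).2 ?_)
    rintro _ ⟨g, h, hd, rfl, rfl⟩
    rw [hU g h hd]
    exact add_le_add (sub_nonneg.mp (hUT g)) (sub_nonneg.mp (hUS h))
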